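/- Let B be a Boolean algebra. The restriction of the mapping C_K (defined by C_K(μ)(b) = μ({x ∈ S(B) : b ∈ x})) to the space Pr(S(B)) of regular Borel probability measures on the Stone space S(B) is an isometric isomorphism between Pr(S(B)) and the set ba₁(B) of all nonnegative additive functions f : B → ℝ with f(1) = 1. -/

import Mathlib

open MeasureTheory

/-- The Stone space of a Boolean algebra `B`: ultrafilters on `B`, encoded as Boolean algebra
homomorphisms `B → Bool`, with the topology induced from the product topology on `B → Bool`. -/
def StoneSpace (B : Type*) [BooleanAlgebra B] : Type _ :=
  {x : B → Bool // x ⊤ = true ∧ x ⊥ = false ∧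
    (∀ a b, x (a ⊓ b) = (x a && x b)) ∧ (∀ a b, x (a ⊔ b) = (x a || x b)) ∧
    (∀ a, x aᶜ = !(x a))}

instance (B : Type*) [BooleanAlgebra B] : TopologicalSpace (StoneSpace B) :=
  instTopologicalSpaceSubtype

/-- The Borel σ-algebra on the Stone space. -/
instance (B : Type*) [BooleanAlgebra B] : MeasurableSpace (StoneSpace B) :=
  borel (StoneSpace B)

instance (B : Type*) [BooleanAlgebra B] : BorelSpace (StoneSpace B) := ⟨rfl⟩

/-- The basic clopen set `K(b) = {x ∈ S(B) : b ∈ x}`. -/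
def KSet {B : Type*} [BooleanAlgebra B] (b : B) : Set (StoneSpace B) :=
  {x | x.1 b = true}

/-- `f : B → ℝ` is additive: `x ⊓ y = ⊥` implies `f (x ⊔ y) = f x + f y`. -/
def IsAdditive {B : Type*} [BooleanAlgebra B] (f : B → ℝ) : Prop :=
  ∀ x y : B, x ⊓ y = ⊥ → f (x ⊔ y) = f x + f y

/-- `f ∈ ba₁(B)`: `f` is additive, takes nonnegative values, and satisfies `f ⊤ = 1`. -/
def MemBaOne {B : Type*} [BooleanAlgebra B] (f : B → ℝ) : Prop :=
  IsAdditive f ∧ (∀ b : B, 0 ≤ f b) ∧ f ⊤ = 1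

/-- The norm of `ba(B)`: `‖f‖ = sup_{b ∈ B} f b − inf_{b ∈ B} f b`. -/
noncomputable def baNorm {B : Type*} [BooleanAlgebra B] (f : B → ℝ) : ℝ :=
  sSup (Set.range f) - sInf (Set.range f)

namespace StoneAux

variable {B : Type*} [BooleanAlgebra B]

lemma isClosed_forall_aux {X ι : Type*} [TopologicalSpace X] {p : ι → X → Prop}
    (h : ∀ i, IsClosed {x | p i x}) : IsClosed {x | ∀ i, p i x} := by
  have : {x | ∀ i, p i x} = ⋂ i, {x | p i x} := by ext; simp
  rw [this]
  exact isClosed_iInter h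

instance : CompactSpace (StoneSpace B) := by
  have : IsClosed {x : B → Bool | x ⊤ = true ∧ x ⊥ = false ∧
    (∀ a b, x (a ⊓ b) = (x a && x b)) ∧ (∀ a b, x (a ⊔ b) = (x a || x b)) ∧
    (∀ a, x aᶜ = !(x a))} := by
    refine IsClosed.inter (isClosed_eq (by fun_prop) (by fun_prop)) ?_
    refine IsClosed.inter (isClosed_eq (by fun_prop) (by fun_prop)) ?_
    refine IsClosed.inter ?_ (IsClosed.inter ?_ ?_)
    · refine isClosed_forall_aux fun a => isClosed_forall_aux fun b =>
        isClosed_eq (by fun_prop) ?_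
      have h1 : Continuous (fun x : B → Bool => (x a, x b)) := by fun_prop
      have h2 : Continuous (fun p : Bool × Bool => (p.1 && p.2)) := continuous_of_discreteTopology
      exact h2.comp h1
    · refine isClosed_forall_aux fun a => isClosed_forall_aux fun b =>
        isClosed_eq (by fun_prop) ?_
      have h1 : Continuous (fun x : B → Bool => (x a, x b)) := by fun_prop
      have h2 : Continuous (fun p : Bool × Bool => (p.1 || p.2)) := continuous_of_discreteTopology
      exact h2.comp h1
    · refine isClosed_forall_aux fun a => isClosed_eq (by fun_prop) ?_
      exact (continuous_of_discreteTopology (f := fun p : Bool => !p)).comp (continuous_apply a)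
  exact isCompact_iff_compactSpace.mp this.isCompact

instance : T2Space (StoneSpace B) :=
  inferInstanceAs (T2Space {x : B → Bool // x ⊤ = true ∧ x ⊥ = false ∧
    (∀ a b, x (a ⊓ b) = (x a && x b)) ∧ (∀ a b, x (a ⊔ b) = (x a || x b)) ∧
    (∀ a, x aᶜ = !(x a))})

lemma continuous_eval (b : B) : Continuous (fun x : StoneSpace B => x.1 b) :=
  (continuous_apply b).comp continuous_subtype_val

lemma isClopen_KSet (b : B) : IsClopen (KSet b) :=
  (isClopen_discrete {true}).preimage (continuous_eval b)

lemma KSet_top : KSet (⊤ : B) = Set.univ := by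
  ext x; simp [KSet, x.2.1]

lemma KSet_bot : KSet (⊥ : B) = ∅ := by
  ext x; simp [KSet, x.2.2.1]

lemma KSet_inf (a b : B) : KSet (a ⊓ b) = KSet a ∩ KSet b := by
  ext x; simp [KSet, x.2.2.2.1]

lemma KSet_sup (a b : B) : KSet (a ⊔ b) = KSet a ∪ KSet b := by
  ext x; simp [KSet, x.2.2.2.2.1]

lemma KSet_compl (a : B) : KSet aᶜ = (KSet a)ᶜ := by
  ext x; simp [KSet, x.2.2.2.2.2]

lemma mem_KSet_finset_inf (I : Finset B) (g : B → B) (x : StoneSpace B) :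
    x ∈ KSet (I.inf g) ↔ ∀ i ∈ I, x ∈ KSet (g i) := by
  classical
  induction I using Finset.induction_on with
  | empty => simp [KSet_top]
  | insert a s ha ih => simp [KSet_inf, ih]

lemma exists_KSet_nhd {U : Set (StoneSpace B)} (hU : IsOpen U) {x : StoneSpace B} (hx : x ∈ U) :
    ∃ b : B, x ∈ KSet b ∧ KSet b ⊆ U := by
  obtain ⟨V, hV, rfl⟩ := isOpen_induced_iff.mp hU
  obtain ⟨I, u, h1, h2⟩ := isOpen_pi_iff.mp hV x.1 hx
  have key : ∀ (y : StoneSpace B) (i : B), y ∈ KSet (if x.1 i = true then i else iᶜ) ↔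
      y.1 i = x.1 i := by
    intro y i
    by_cases h : x.1 i = true
    · simp [h, KSet]
    · simp [h, KSet, y.2.2.2.2.2]
  refine ⟨I.inf (fun i => if x.1 i = true then i else iᶜ), ?_, ?_⟩
  · rw [mem_KSet_finset_inf]
    intro i _
    rw [key]
  · intro y hy
    rw [mem_KSet_finset_inf] at hy
    apply h2
    intro i hi
    rw [(key y i).mp (hy i hi)]
    exact (h1 i hi).2

lemma exists_KSet_between {K U : Set (StoneSpace B)} (hK : IsCompact K) (hU : IsOpen U)
    (h : K ⊆ U) : ∃ b : B, K ⊆ KSet b ∧ KSet b ⊆ U := by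
  refine hK.induction_on (p := fun s => ∃ b : B, s ⊆ KSet b ∧ KSet b ⊆ U) ?_ ?_ ?_ ?_
  · exact ⟨⊥, by simp, by simp [KSet_bot]⟩
  · rintro s t hst ⟨b, h1, h2⟩
    exact ⟨b, hst.trans h1, h2⟩
  · rintro s t ⟨b, h1, h2⟩ ⟨c, h3, h4⟩
    refine ⟨b ⊔ c, ?_, ?_⟩
    · rw [KSet_sup]; exact Set.union_subset_union h1 h3
    · rw [KSet_sup]; exact Set.union_subset h2 h4
  · intro x hx
    obtain ⟨b, h1, h2⟩ := exists_KSet_nhd hU (h hx)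
    exact ⟨KSet b, mem_nhdsWithin_of_mem_nhds ((isClopen_KSet b).isOpen.mem_nhds h1), b,
      subset_rfl, h2⟩

lemma eq_bot_of_KSet {b : B} (h : KSet b = ∅) : b = ⊥ := by
  by_contra hb
  obtain ⟨J, hJ, h1, h2⟩ := DistribLattice.prime_ideal_of_disjoint_filter_ideal
    (F := Order.PFilter.principal b) (I := Order.Ideal.principal (⊥ : B)) (by
      rw [Set.disjoint_left]
      intro y hy hy'
      have hy : b ≤ y := by simpa using hy
      have hy' : y ≤ ⊥ := Order.Ideal.mem_principal.mp hy'
      exact hb (le_bot_iff.mp (hy.trans hy')))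
  classical
  have hbJ : b ∉ J := Set.disjoint_left.mp h2 (by simp)
  have hc : ∀ a, a ∈ J → aᶜ ∉ J := fun a ha hac => by
    have : a ⊔ aᶜ ∈ J := Order.Ideal.sup_mem ha hac
    rw [sup_compl_eq_top] at this
    exact hbJ (J.lower le_top this)
  let x : StoneSpace B := ⟨fun a => decide (a ∉ J), by
    refine ⟨?_, ?_, ?_, ?_, ?_⟩
    · simpa using fun h => hbJ (J.lower le_top h)
    · simp
    · intro a c
      have : a ⊓ c ∈ J ↔ a ∈ J ∨ c ∈ J := ⟨hJ.mem_or_mem,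
        fun h => h.elim (fun h => J.lower inf_le_left h) (fun h => J.lower inf_le_right h)⟩
      simp [this]
    · intro a c
      simp [Order.Ideal.sup_mem_iff, Bool.decide_or, imp_iff_not_or]
    · intro a
      have : aᶜ ∈ J ↔ a ∉ J := ⟨fun h h' => hc a h' h, fun h => hJ.compl_mem_of_notMem h⟩
      simp [this]⟩
  have : x ∈ KSet b := decide_eq_true hbJ
  rw [h] at this
  exact this

lemma le_of_KSet {b c : B} (h : KSet b ⊆ KSet c) : b ≤ c := by
  rw [← sdiff_eq_bot_iff, sdiff_eq]
  apply eq_bot_of_KSet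
  rw [KSet_inf, KSet_compl, ← Set.sdiff_eq, Set.sdiff_eq_empty]
  exact h

section content

variable {f : B → ℝ}

lemma f_mono (hf : MemBaOne f) {b c : B} (h : b ≤ c) : f b ≤ f c := by
  have := hf.1 b (c \ b) inf_sdiff_self_right
  rw [sup_sdiff_cancel_right h] at this
  linarith [hf.2.1 (c \ b)]

lemma f_sup_le (hf : MemBaOne f) (b c : B) : f (b ⊔ c) ≤ f b + f c := by
  have := hf.1 b (c \ b) inf_sdiff_self_right
  rw [sup_sdiff_self_right] at this
  linarith [f_mono hf (sdiff_le : c \ b ≤ c)]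

/-- outer value of a set -/
noncomputable def outer (f : B → ℝ) (K : Set (StoneSpace B)) : ℝ :=
  sInf (Set.image f {b | K ⊆ KSet b})

lemma outer_nonneg (hf : MemBaOne f) (K : Set (StoneSpace B)) : 0 ≤ outer f K :=
  Real.sInf_nonneg (by rintro _ ⟨b, -, rfl⟩; exact hf.2.1 b)

lemma outer_le (hf : MemBaOne f) {K : Set (StoneSpace B)} {b : B} (h : K ⊆ KSet b) :
    outer f K ≤ f b :=
  csInf_le ⟨0, by rintro _ ⟨b, -, rfl⟩; exact hf.2.1 b⟩ ⟨b, h, rfl⟩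

lemma le_outer {K : Set (StoneSpace B)} {c : ℝ} (h : ∀ b : B, K ⊆ KSet b → c ≤ f b) :
    c ≤ outer f K :=
  le_csInf ⟨_, ⊤, by simp [KSet_top], rfl⟩ (by rintro _ ⟨b, hb, rfl⟩; exact h b hb)

lemma outer_KSet (hf : MemBaOne f) (b : B) : outer f (KSet b) = f b :=
  le_antisymm (outer_le hf subset_rfl) (le_outer fun _ h => f_mono hf (le_of_KSet h))

lemma outer_union_le (hf : MemBaOne f) (K L : Set (StoneSpace B)) :
    outer f (K ∪ L) ≤ outer f K + outer f L := by
  have h1 : outer f (K ∪ L) - outer f L ≤ outer f K := le_outer fun b hb => by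
    have h2 : outer f (K ∪ L) - f b ≤ outer f L := le_outer fun c hc => by
      have : outer f (K ∪ L) ≤ f (b ⊔ c) := outer_le hf (by
        rw [KSet_sup]; exact Set.union_subset_union hb hc)
      linarith [f_sup_le hf b c]
    linarith
  linarith

lemma outer_union (hf : MemBaOne f) {K L : Set (StoneSpace B)} (hK : IsCompact K)
    (hL : IsClosed L) (h : Disjoint K L) :
    outer f (K ∪ L) = outer f K + outer f L := by
  apply le_antisymm (outer_union_le hf K L)
  obtain ⟨c, hc1, hc2⟩ := exists_KSet_between hK hL.isOpen_compl (Set.disjoint_left.mp h)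
  apply le_outer
  intro b hb
  have e := hf.1 (b ⊓ c) (b ⊓ cᶜ) (by
    rw [inf_inf_inf_comm, inf_compl_self]; simp)
  rw [← inf_sup_left, sup_compl_eq_top, inf_top_eq] at e
  rw [e]
  refine add_le_add (outer_le hf ?_) (outer_le hf ?_)
  · rw [KSet_inf]; exact Set.subset_inter (Set.subset_union_left.trans hb) hc1
  · rw [KSet_inf, KSet_compl]
    exact Set.subset_inter (Set.subset_union_right.trans hb) (fun x hx hx' => hc2 hx' hx)

/-- The content attached to an additive function. -/
noncomputable def content (hf : MemBaOne f) : Content (StoneSpace B) where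
  toFun K := NNReal.mk (outer f K) (outer_nonneg hf _)
  mono' K L h := by
    rw [← NNReal.coe_le_coe]
    exact le_outer fun b hb => outer_le hf (h.trans hb)
  sup_disjoint' K L h _ hL := by
    rw [← NNReal.coe_inj]
    exact outer_union hf K.isCompact hL h
  sup_le' K L := by
    rw [← NNReal.coe_le_coe]
    exact outer_union_le hf _ _

lemma content_measure (hf : MemBaOne f) (b : B) :
    (content hf).measure (KSet b) = ENNReal.ofReal (f b) := by
  rw [Content.measure_apply _ (isClopen_KSet b).isOpen.measurableSet,
    Content.outerMeasure_of_isOpen _ _ (isClopen_KSet b).isOpen,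
    Content.innerContent_of_isCompact _ (isClopen_KSet b).isClosed.isCompact,
    ENNReal.ofReal_eq_coe_nnreal (hf.2.1 b)]
  change ((content hf).toFun _ : ENNReal) = _
  congr 1
  exact NNReal.coe_injective (outer_KSet hf b)

end content

lemma approx_one (μ : Measure (StoneSpace B)) [IsProbabilityMeasure μ] [μ.Regular]
    {A : Set (StoneSpace B)} (hA : MeasurableSet A) {ε : ℝ} (hε : 0 < ε) :
    ∃ K U, IsCompact K ∧ IsOpen U ∧ K ⊆ A ∧ A ⊆ U ∧
      μ.real A ≤ μ.real K + ε ∧ μ.real U ≤ μ.real A + ε := by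
  have h0 : ENNReal.ofReal ε ≠ 0 := by simpa using hε
  obtain ⟨K, h1, h2, h3⟩ := hA.exists_isCompact_lt_add (measure_ne_top μ A) h0
  obtain ⟨U, h4, h5, h6⟩ := A.exists_isOpen_lt_add (measure_ne_top μ A) h0
  refine ⟨K, U, h2, h5, h1, h4, ?_, ?_⟩
  · have := ENNReal.toReal_mono (by finiteness) h3.le
    rwa [ENNReal.toReal_add (by finiteness) (by finiteness), ENNReal.toReal_ofReal hε.le] at this
  · have := ENNReal.toReal_mono (by finiteness) h6.le
    rwa [ENNReal.toReal_add (by finiteness) (by finiteness), ENNReal.toReal_ofReal hε.le] at this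

lemma approx (μ ν : Measure (StoneSpace B)) [IsProbabilityMeasure μ] [IsProbabilityMeasure ν]
    [μ.Regular] [ν.Regular]
    {A : Set (StoneSpace B)} (hA : MeasurableSet A) {ε : ℝ} (hε : 0 < ε) :
    ∃ b : B, |μ.real A - μ.real (KSet b)| ≤ ε ∧ |ν.real A - ν.real (KSet b)| ≤ ε := by
  obtain ⟨K, U, h1, h2, h3, h4, h5, h6⟩ := approx_one μ hA hε
  obtain ⟨K', U', h1', h2', h3', h4', h5', h6'⟩ := approx_one ν hA hε
  obtain ⟨b, hb1, hb2⟩ := exists_KSet_between (h1.union h1') (h2.inter h2')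
    ((Set.union_subset h3 h3').trans (Set.subset_inter h4 h4'))
  refine ⟨b, ?_, ?_⟩
  · have e1 : μ.real K ≤ μ.real (KSet b) := measureReal_mono (Set.subset_union_left.trans hb1)
    have e2 : μ.real (KSet b) ≤ μ.real U := measureReal_mono (hb2.trans Set.inter_subset_left)
    rw [abs_le]; constructor <;> linarith
  · have e1 : ν.real K' ≤ ν.real (KSet b) := measureReal_mono (Set.subset_union_right.trans hb1)
    have e2 : ν.real (KSet b) ≤ ν.real U' := measureReal_mono (hb2.trans Set.inter_subset_right)
    rw [abs_le]; constructor <;> linarith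

lemma isometry_aux (μ ν : Measure (StoneSpace B)) [IsProbabilityMeasure μ]
    [IsProbabilityMeasure ν] [μ.Regular] [ν.Regular] :
    ((μ.toSignedMeasure - ν.toSignedMeasure).totalVariation Set.univ).toReal =
        baNorm (fun b => (μ (KSet b)).toReal - (ν (KSet b)).toReal) := by
  set s := μ.toSignedMeasure - ν.toSignedMeasure with hs
  have sval : ∀ A, MeasurableSet A → s A = μ.real A - ν.real A := fun A hA => by
    rw [hs, Measure.toSignedMeasure_sub_apply hA]
  obtain ⟨i, hi, hi2, hi3, hp, hn⟩ := s.toJordanDecomposition_spec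
  have hP : s.toJordanDecomposition.posPart.real Set.univ = s i := by
    rw [hp, SignedMeasure.toMeasureOfZeroLE_real_apply _ hi2 hi .univ, Set.inter_univ]
  have hN : s.toJordanDecomposition.negPart.real Set.univ = - s iᶜ := by
    rw [hn, SignedMeasure.toMeasureOfLEZero_real_apply _ hi3 hi.compl .univ, Set.inter_univ]
  have hdec : ∀ A, MeasurableSet A → s A = s.toJordanDecomposition.posPart.real A
      - s.toJordanDecomposition.negPart.real A := fun A hA => by
    conv_lhs => rw [← s.toSignedMeasure_toJordanDecomposition]
    rw [JordanDecomposition.toSignedMeasure, Measure.toSignedMeasure_sub_apply hA]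
  have hub : ∀ A, MeasurableSet A → s A ≤ s i := fun A hA => by
    have h1 : s.toJordanDecomposition.posPart.real A ≤ s.toJordanDecomposition.posPart.real .univ :=
      measureReal_mono (Set.subset_univ _)
    have h2 : 0 ≤ s.toJordanDecomposition.negPart.real A := measureReal_nonneg
    linarith [hdec A hA]
  have hlb : ∀ A, MeasurableSet A → s iᶜ ≤ s A := fun A hA => by
    have h1 : s.toJordanDecomposition.negPart.real A ≤ s.toJordanDecomposition.negPart.real .univ :=
      measureReal_mono (Set.subset_univ _)
    have h2 : 0 ≤ s.toJordanDecomposition.posPart.real A := measureReal_nonneg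
    linarith [hdec A hA]
  have hK : ∀ b : B, MeasurableSet (KSet b) := fun b => (isClopen_KSet b).isOpen.measurableSet
  have happ : ∀ A, MeasurableSet A → ∀ ε > 0, ∃ b : B, |s A - s (KSet b)| ≤ ε := by
    intro A hA ε hε
    obtain ⟨b, h1, h2⟩ := approx μ ν hA (half_pos hε)
    refine ⟨b, ?_⟩
    rw [sval A hA, sval _ (hK b)]
    rw [abs_le] at *
    constructor <;> linarith
  have hfun : (fun b : B => (μ (KSet b)).toReal - (ν (KSet b)).toReal) = fun b => s (KSet b) := by
    funext b
    exact (sval _ (hK b)).symm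
  have hsup : sSup (Set.range fun b : B => s (KSet b)) = s i := by
    apply csSup_eq_of_forall_le_of_forall_lt_exists_gt (Set.range_nonempty _)
    · rintro _ ⟨b, rfl⟩; exact hub _ (hK b)
    · intro w hw
      obtain ⟨b, hb⟩ := happ i hi ((s i - w) / 2) (by linarith)
      rw [abs_le] at hb
      exact ⟨_, ⟨b, rfl⟩, by linarith⟩
  have hinf : sInf (Set.range fun b : B => s (KSet b)) = s iᶜ := by
    apply csInf_eq_of_forall_ge_of_forall_gt_exists_lt (Set.range_nonempty _)
    · rintro _ ⟨b, rfl⟩; exact hlb _ (hK b)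
    · intro w hw
      obtain ⟨b, hb⟩ := happ iᶜ hi.compl ((w - s iᶜ) / 2) (by linarith)
      rw [abs_le] at hb
      exact ⟨_, ⟨b, rfl⟩, by linarith⟩
  rw [hfun, baNorm, hsup, hinf, SignedMeasure.totalVariation]
  change Measure.real _ _ = _
  rw [measureReal_add_apply, hP, hN, sub_eq_add_neg]

end StoneAux

/-- The restriction of `C_K` (given by `C_K(μ)(b) = μ(K(b))`) to the space
`Pr(S(B))` of regular Borel probability measures on the Stone space `S(B)` is an isometric
isomorphism between `Pr(S(B))` (with the total variation distance) and the set `ba₁(B)` of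
nonnegative additive functions `f : B → ℝ` with `f(⊤) = 1` (with the distance induced by the
`ba` norm `sup − inf`): it maps into `ba₁(B)`, is injective, surjective onto `ba₁(B)`, and
preserves distances. -/
theorem prob_isometric_iso_baOne (B : Type*) [BooleanAlgebra B] :
    -- `C_K μ ∈ ba₁(B)` for every regular Borel probability measure `μ`
    (∀ (μ : Measure (StoneSpace B)) [IsProbabilityMeasure μ], μ.Regular →
      MemBaOne (fun b => (μ (KSet b)).toReal)) ∧
    -- injectivity
    (∀ (μ ν : Measure (StoneSpace B)) [IsProbabilityMeasure μ] [IsProbabilityMeasure ν],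
      μ.Regular → ν.Regular →
      (∀ b : B, (μ (KSet b)).toReal = (ν (KSet b)).toReal) → μ = ν) ∧
    -- surjectivity onto `ba₁(B)`
    (∀ f : B → ℝ, MemBaOne f → ∃ μ : Measure (StoneSpace B),
      IsProbabilityMeasure μ ∧ μ.Regular ∧ ∀ b : B, (μ (KSet b)).toReal = f b) ∧
    -- the map is isometric: the total variation distance between `μ` and `ν` equals the
    -- `ba`-norm of the difference of the corresponding additive functions
    (∀ (μ ν : Measure (StoneSpace B)) [IsProbabilityMeasure μ] [IsProbabilityMeasure ν],
      μ.Regular → ν.Regular →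
      ((μ.toSignedMeasure - ν.toSignedMeasure).totalVariation Set.univ).toReal =
        baNorm (fun b => (μ (KSet b)).toReal - (ν (KSet b)).toReal)) := by
  refine ⟨?_, ?_, ?_, ?_⟩
  · intro μ _ _
    refine ⟨?_, fun b => ENNReal.toReal_nonneg, by simp [StoneAux.KSet_top]⟩
    intro x y hxy
    change (μ (KSet (x ⊔ y))).toReal = _
    rw [StoneAux.KSet_sup, measure_union _ (StoneAux.isClopen_KSet y).isOpen.measurableSet,
      ENNReal.toReal_add (by finiteness) (by finiteness)]
    rw [Set.disjoint_iff_inter_eq_empty, ← StoneAux.KSet_inf, hxy, StoneAux.KSet_bot]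
  · intro μ ν _ _ hμ hν h
    ext A hA
    rw [← ENNReal.toReal_eq_toReal_iff' (by finiteness) (by finiteness)]
    refine eq_of_forall_dist_le fun ε hε => ?_
    obtain ⟨b, h1, h2⟩ := StoneAux.approx μ ν hA (half_pos hε)
    have h3 : μ.real (KSet b) = ν.real (KSet b) := h b
    change |μ.real A - ν.real A| ≤ ε
    rw [abs_le] at *
    constructor <;> linarith
  · intro f hf
    refine ⟨(StoneAux.content hf).measure, ⟨?_⟩, inferInstance, fun b => ?_⟩
    · rw [← StoneAux.KSet_top, StoneAux.content_measure, hf.2.2, ENNReal.ofReal_one]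
    · rw [StoneAux.content_measure, ENNReal.toReal_ofReal (hf.2.1 b)]
  · intro μ ν _ _ hμ hν
    exact StoneAux.isometry_aux μ ν
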